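/- arXiv:2511.04609 — 2 statements merged into one kernel-verified Lean document; each statement's English description precedes it below -/
import Mathlib

section
/- Let K be an algebraically closed field of characteristic zero, and let L be a Lie subalgebra of sl(3,K) (the Lie algebra of trace-zero 3×3 matrices over K under the commutator bracket) which is semisimple as a Lie algebra. Then exactly one of the following holds: (1) L is the zero subalgebra; (2) L is isomorphic, as a Lie algebra over K, to sl(2,K); (3) L equals sl(3,K). -/
section SL3Aux

attribute [local instance] LieRing.ofAssociativeRing
open LieAlgebra LieAlgebra.SpecialLinear LieModule Module

lemma aux_sl2_equiv {K L : Type*} [Field K] [CharZero K] [LieRing L] [LieAlgebra K L]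
    {h e f : L} (t : IsSl2Triple h e f)
    (hspan : ∀ x : L, ∃ a b c : K, x = a • e + b • f + c • h) :
    Nonempty (L ≃ₗ⁅K⁆ ↥(sl (Fin 2) K)) := by
  have hhe : ⁅h, e⁆ = (2 : K) • e := t.lie_h_e_smul K
  have hhf : ⁅h, f⁆ = -((2 : K) • f) := t.lie_lie_smul_f K
  have heh : ⁅e, h⁆ = -((2 : K) • e) := by rw [← lie_skew, hhe]
  have hfh : ⁅f, h⁆ = (2 : K) • f := by rw [← lie_skew, hhf, neg_neg]
  have hfe : ⁅f, e⁆ = -h := by rw [← lie_skew, t.lie_e_f]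
  have htr : ∀ A : sl (Fin 2) K, A.1 1 1 = - A.1 0 0 := by
    intro A
    have h1 : Matrix.trace A.1 = 0 := A.2
    rw [Matrix.trace_fin_two] at h1
    linear_combination h1
  let φ : sl (Fin 2) K →ₗ⁅K⁆ L :=
    { toFun := fun A => A.1 0 1 • e + A.1 1 0 • f + A.1 0 0 • h
      map_add' := by intro A B; simp; module
      map_smul' := by intro c A; simp; module
      map_lie' := by
        intro A B
        have hA := htr A
        have hB := htr B
        simp only [sl_bracket, Matrix.sub_apply, Matrix.mul_apply, Fin.sum_univ_two, hA, hB,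
          lie_add, add_lie, lie_smul, smul_lie, lie_self, t.lie_e_f, hhe, hhf, heh, hfh, hfe]
        module }
  have hinj : Function.Injective φ := by
    rw [injective_iff_map_eq_zero]
    intro A hA
    have h0 : A.1 0 1 • e + A.1 1 0 • f + A.1 0 0 • h = 0 := hA
    have h1 := congrArg (fun x => ⁅h, x⁆) h0
    have h2 := congrArg (fun x => ⁅h, ⁅h, x⁆⁆) h0
    simp only [lie_add, lie_smul, hhe, hhf, lie_self, lie_neg, lie_zero, smul_zero, add_zero] at h1 h2
    have ha : (8 * A.1 0 1) • e = 0 := by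
      have : (8 * A.1 0 1) • e = (2 : K) • (0 : L) + (0 : L) := by
        nth_rewrite 1 [← h1]; rw [← h2]; module
      simpa using this
    have hb : (8 * A.1 1 0) • f = 0 := by
      have : (8 * A.1 1 0) • f = (-2 : K) • (0 : L) + (0 : L) := by
        nth_rewrite 1 [← h1]; rw [← h2]; module
      simpa using this
    have ha' : A.1 0 1 = 0 := by simpa [t.e_ne_zero] using ha
    have hb' : A.1 1 0 = 0 := by simpa [t.f_ne_zero] using hb
    have hc' : A.1 0 0 = 0 := by simpa [t.h_ne_zero, ha', hb'] using h0
    ext i j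
    fin_cases i <;> fin_cases j <;> simp [ha', hb', hc', htr A]
  have hsurj : Function.Surjective φ := by
    intro x
    obtain ⟨a, b, c, rfl⟩ := hspan x
    refine ⟨⟨!![c, a; b, -c], ?_⟩, ?_⟩
    · change Matrix.trace !![c, a; b, -c] = 0
      simp [Matrix.trace_fin_two]
    · change _ • e + _ • f + _ • h = _
      simp
  exact ⟨(LieEquiv.ofBijective φ ⟨hinj, hsurj⟩).symm⟩

lemma aux_rank_one {K L : Type*} [Field K] [IsAlgClosed K] [CharZero K] [LieRing L]
    [LieAlgebra K L] [FiniteDimensional K L] [IsKilling K L]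
    (H : LieSubalgebra K L) [H.IsCartanSubalgebra] (hH : finrank K H = 1) :
    Nonempty (L ≃ₗ⁅K⁆ ↥(sl (Fin 2) K)) := by
  have hdual : finrank K (Module.Dual K H) = 1 := by rw [Subspace.dual_finrank_eq, hH]
  obtain ⟨α, hα⟩ : ∃ α : Weight K H L, α.IsNonZero := by
    by_contra! hcon
    have := IsKilling.span_weight_isNonZero_eq_top K L H
    have he : {α : Weight K H L | α.IsNonZero} = ∅ := by
      ext α; simpa using hcon α
    rw [he, Set.image_empty, Submodule.span_empty] at this
    have h2 := finrank_top K (Module.Dual K H)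
    rw [← this, finrank_bot, hdual] at h2
    omega
  obtain ⟨h, e, f, t, he, hf⟩ := IsKilling.exists_isSl2Triple_of_weight_isNonZero hα
  refine aux_sl2_equiv t fun x => ?_
  have hh := t.h_eq_coroot hα he hf
  suffices x ∈ IsKilling.sl2SubmoduleOfRoot hα by
    have h2 : x ∈ IsKilling.sl2SubalgebraOfRoot hα := this
    rw [IsKilling.mem_sl2SubalgebraOfRoot_iff hα t he hf, t.lie_e_f] at h2
    exact h2
  have htop := iSup_genWeightSpace_eq_top' K H L
  have hx : x ∈ (⊤ : LieSubmodule K H L) := LieSubmodule.mem_top x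
  rw [← htop] at hx
  refine (iSup_le (fun β => ?_) : _ ≤ IsKilling.sl2SubmoduleOfRoot hα) hx
  by_cases hβ : β.IsZero
  · rw [hβ.eq]
    intro y hy
    replace hy : y ∈ H := by
      rw [← LieSubalgebra.mem_toLieSubmodule, ← rootSpace_zero_eq K L H]; exact hy
    have hc : IsKilling.coroot α ≠ 0 := by
      rw [Ne, IsKilling.coroot_eq_zero_iff]; exact hα
    obtain ⟨c, hc⟩ := exists_smul_eq_of_finrank_eq_one hH hc ⟨y, hy⟩
    have : y = c • h := by rw [hh]; exact (congrArg Subtype.val hc).symm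
    change y ∈ IsKilling.sl2SubalgebraOfRoot hα
    rw [IsKilling.mem_sl2SubalgebraOfRoot_iff hα t he hf, t.lie_e_f]
    exact ⟨0, 0, c, by simp [this]⟩
  · have hαl : α.toLinear ≠ 0 := by
      rw [Ne, Weight.coe_toLinear_eq_zero_iff]; exact hα
    obtain ⟨c, hc⟩ := exists_smul_eq_of_finrank_eq_one hdual hαl β.toLinear
    rw [IsKilling.sl2SubmoduleOfRoot_eq_sup]
    rcases IsKilling.eq_neg_or_eq_of_eq_smul α β hβ c
      (by ext y; exact (DFunLike.congr_fun hc y).symm) with h1 | h1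
    · subst h1
      exact (le_sup_right).trans le_sup_left
    · subst h1
      exact le_sup_left.trans le_sup_left

lemma aux_weights_faithful {K L V : Type*} [Field K] [IsAlgClosed K] [CharZero K] [LieRing L]
    [LieAlgebra K L] [FiniteDimensional K L] [IsKilling K L]
    (H : LieSubalgebra K L) [H.IsCartanSubalgebra]
    [AddCommGroup V] [Module K V] [FiniteDimensional K V] [LieRingModule L V] [LieModule K L V]
    (hinj : Function.Injective (toEnd K L V)) (h : H)
    (h0 : ∀ χ : Weight K H V, χ h = 0) : h = 0 := by
  have hnil : IsNilpotent (toEnd K L V h) := by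
    rw [Module.End.isNilpotent_iff_of_finite]
    intro v
    have htop := iSup_genWeightSpace_eq_top' K H V
    have hv : v ∈ (⊤ : LieSubmodule K H V) := LieSubmodule.mem_top v
    rw [← htop] at hv
    have hle : (⨆ χ : Weight K H V, genWeightSpace V χ) ≤ genWeightSpaceOf V (0 : K) h := by
      refine iSup_le fun χ => ?_
      rw [← h0 χ]
      exact genWeightSpace_le_genWeightSpaceOf V h χ
    have := hle hv
    rw [mem_genWeightSpaceOf] at this
    obtain ⟨k, hk⟩ := this
    refine ⟨k, ?_⟩
    have hk' : ((toEnd K H V h) ^ k) v = 0 := by simpa using hk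
    exact hk'
  have hnil2 := LieAlgebra.ad_nilpotent_of_nilpotent (R := K) hnil
  have hnil3 : IsNilpotent (ad K L (h : L)) := by
    obtain ⟨n, hn⟩ := hnil2
    refine ⟨n, ?_⟩
    have key : ∀ (m : ℕ) (x : L), toEnd K L V (((ad K L (h : L)) ^ m) x) =
        ((ad K (Module.End K V) (toEnd K L V h)) ^ m) (toEnd K L V x) := by
      intro m
      induction m with
      | zero => intro x; simp
      | succ m ih =>
        intro x
        rw [pow_succ, pow_succ, Module.End.mul_apply, Module.End.mul_apply, ih]
        simp
    ext x
    apply hinj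
    rw [key, hn]; simp
  exact Subtype.ext
    (IsKilling.eq_zero_of_isNilpotent_ad_of_mem_isCartanSubalgebra K L H h.2 hnil3)

lemma aux_trace {K H V : Type*} [Field K] [IsAlgClosed K] [CharZero K] [LieRing H]
    [LieAlgebra K H] [LieRing.IsNilpotent H] [FiniteDimensional K H]
    [AddCommGroup V] [Module K V] [FiniteDimensional K V] [LieRingModule H V] [LieModule K H V]
    (h : H) :
    LinearMap.trace K V (toEnd K H V h) =
      ∑ χ : Weight K H V, finrank K (genWeightSpace V χ) • χ h := by
  classical
  have hds := DirectSum.isInternal_submodule_of_iSupIndep_of_iSup_eq_top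
    (LieSubmodule.iSupIndep_toSubmodule.mpr <| iSupIndep_genWeightSpace' K H V)
    (LieSubmodule.iSup_toSubmodule_eq_top.mpr <| iSup_genWeightSpace_eq_top' K H V)
  have hm : ∀ χ : Weight K H V, Set.MapsTo (toEnd K H V h)
      (genWeightSpace V χ).toSubmodule (genWeightSpace V χ).toSubmodule :=
    fun χ v hv => (genWeightSpace V χ).lie_mem hv
  rw [LinearMap.trace_eq_sum_trace_restrict hds hm]
  refine Finset.sum_congr rfl fun χ _ => ?_
  exact trace_toEnd_genWeightSpace K H V χ h

lemma aux_card_le {K H V : Type*} [Field K] [IsAlgClosed K] [CharZero K] [LieRing H]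
    [LieAlgebra K H] [LieRing.IsNilpotent H] [FiniteDimensional K H]
    [AddCommGroup V] [Module K V] [FiniteDimensional K V] [LieRingModule H V] [LieModule K H V] :
    ∃ v : Weight K H V → V, LinearIndependent K v ∧ ∀ χ (h : H), ⁅h, v χ⁆ = χ h • v χ := by
  have := fun χ : Weight K H V => exists_forall_lie_eq_smul K H V χ
  choose v hv0 hv using this
  refine ⟨v, ?_, hv⟩
  have hind := LieSubmodule.iSupIndep_toSubmodule.mpr <| iSupIndep_genWeightSpace' K H V
  refine hind.linearIndependent _ (fun χ => ?_) hv0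
  exact (mem_genWeightSpace V χ (v χ)).mpr fun x ↦ ⟨1, by simp [← hv χ x]⟩

lemma aux_finrank_lt {K L V : Type*} [Field K] [IsAlgClosed K] [CharZero K] [LieRing L]
    [LieAlgebra K L] [FiniteDimensional K L] [IsKilling K L]
    (H : LieSubalgebra K L) [H.IsCartanSubalgebra]
    [AddCommGroup V] [Module K V] [FiniteDimensional K V] [LieRingModule L V] [LieModule K L V]
    (hinj : Function.Injective (toEnd K L V)) (htr : ∀ x, LinearMap.trace K V (toEnd K L V x) = 0)
    [Nontrivial V] :
    finrank K H + 1 ≤ Fintype.card (Weight K H V) := by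
  let ev : H →ₗ[K] (Weight K H V → K) := LinearMap.pi fun χ => χ.toLinear
  let lam : (Weight K H V → K) →ₗ[K] K :=
    ∑ χ : Weight K H V, (finrank K (genWeightSpace V χ) : K) • LinearMap.proj χ
  have hev : Function.Injective ev := by
    rw [injective_iff_map_eq_zero]
    intro h hh
    exact aux_weights_faithful H hinj h fun χ => congrFun hh χ
  have hle : LinearMap.range ev ≤ LinearMap.ker lam := by
    rintro _ ⟨h, rfl⟩
    have h1 := aux_trace (K := K) (V := V) h
    have h2 := htr h
    have h3 : toEnd K H V h = toEnd K L V h := rfl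
    rw [h3, h2] at h1
    rw [LinearMap.mem_ker, h1]
    simp [lam, ev]
  have : Nonempty (Weight K H V) := by
    by_contra hne
    rw [not_nonempty_iff] at hne
    have htop := iSup_genWeightSpace_eq_top' K H V
    rw [iSup_of_empty] at htop
    exact bot_ne_top htop
  obtain ⟨χ0⟩ := this
  have hlam : Function.Surjective lam := by
    apply LinearMap.surjective
    intro h0
    classical
    have := LinearMap.congr_fun h0 (Pi.single χ0 1)
    simp [lam, Pi.single_apply] at this
    exact χ0.genWeightSpace_ne_bot _ ((LieSubmodule.toSubmodule_eq_bot _).mp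
      (Submodule.finrank_eq_zero.mp this))
  have h1 := LinearMap.finrank_range_add_finrank_ker lam
  rw [LinearMap.range_eq_top.mpr hlam, finrank_top, finrank_self, finrank_fintype_fun_eq_card] at h1
  have h2 := Submodule.finrank_mono hle
  rw [LinearMap.finrank_range_of_inj hev] at h2
  omega

lemma aux_eigenbasis {K L V : Type*} [Field K] [IsAlgClosed K] [CharZero K] [LieRing L]
    [LieAlgebra K L] [FiniteDimensional K L] [IsKilling K L]
    (H : LieSubalgebra K L) [H.IsCartanSubalgebra]
    [AddCommGroup V] [Module K V] [FiniteDimensional K V] [LieRingModule L V] [LieModule K L V]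
    (hinj : Function.Injective (toEnd K L V)) (htr : ∀ x, LinearMap.trace K V (toEnd K L V x) = 0)
    (hV : finrank K V = 3) :
    finrank K H ≤ 2 ∧ (finrank K H = 2 →
      ∃ (b : Basis (Fin 3) K V) (χ : H →ₗ[K] (Fin 3 → K)),
        (∀ (h : H) i, ⁅h, b i⁆ = χ h i • b i) ∧ ∀ d : Fin 3 → K, d 0 + d 1 + d 2 = 0 →
          ∃ h, χ h = d) := by
  have : Nontrivial V := Module.nontrivial_of_finrank_pos (R := K) (by omega)
  have hlt := aux_finrank_lt H hinj htr
  obtain ⟨v, hv, hvw⟩ := aux_card_le (K := K) (H := H) (V := V)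
  have hc := hv.fintype_card_le_finrank
  refine ⟨by omega, fun h2 => ?_⟩
  have hc3 : Fintype.card (Weight K H V) = 3 := by omega
  have : Nonempty (Weight K H V) := Fintype.card_pos_iff.mp (by omega)
  let e := Fintype.equivFinOfCardEq hc3
  let b := (basisOfLinearIndependentOfCardEqFinrank hv (by omega)).reindex e
  have hb : ∀ i, b i = v (e.symm i) := by intro i; simp [b]
  let χ : H →ₗ[K] (Fin 3 → K) := LinearMap.pi fun i => (e.symm i).toLinear
  have hχ : ∀ h i, χ h i = (e.symm i) h := fun h i => rfl
  have hbw : ∀ (h : H) i, ⁅h, b i⁆ = χ h i • b i := by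
    intro h i; rw [hb, hvw, hχ]
  refine ⟨b, χ, hbw, ?_⟩
  have hχinj : Function.Injective χ := by
    rw [injective_iff_map_eq_zero]
    intro h hh
    refine aux_weights_faithful H hinj h fun ψ => ?_
    have := congrFun hh (e ψ)
    simpa [hχ] using this
  let S : (Fin 3 → K) →ₗ[K] K := ∑ i, LinearMap.proj i
  have hS : Function.Surjective S := by
    apply LinearMap.surjective
    intro h0
    have := LinearMap.congr_fun h0 (Pi.single 0 1)
    simp [S] at this
  have hle : LinearMap.range χ ≤ LinearMap.ker S := by
    rintro _ ⟨h, rfl⟩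
    have h1 := htr h
    rw [LinearMap.trace_eq_matrix_trace K b, Matrix.trace] at h1
    rw [LinearMap.mem_ker, ← h1]
    simp only [S, LinearMap.sum_apply, LinearMap.proj_apply]
    refine Finset.sum_congr rfl fun i _ => ?_
    have h3 : (toEnd K L V h) (b i) = χ h i • b i := hbw h i
    simp [LinearMap.toMatrix_apply, h3]
  have h1 := LinearMap.finrank_range_add_finrank_ker S
  rw [LinearMap.range_eq_top.mpr hS, finrank_top, finrank_self, finrank_fintype_fun_eq_card,
    Fintype.card_fin] at h1
  have heq : LinearMap.range χ = LinearMap.ker S := by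
    apply Submodule.eq_of_le_of_finrank_eq hle
    rw [LinearMap.finrank_range_of_inj hχinj]; omega
  intro d hd
  have : d ∈ LinearMap.range χ := by
    rw [heq, LinearMap.mem_ker]; simpa [S, Fin.sum_univ_three] using hd
  exact this

/-- a generic element of the diagonal torus -/
def auxD (K : Type*) [Field K] : Fin 3 → K := ![-4/3, -1/3, 5/3]

lemma auxD_sum (K : Type*) [Field K] [CharZero K] : auxD K 0 + auxD K 1 + auxD K 2 = 0 := by
  simp [auxD]; norm_num

lemma auxD_inj (K : Type*) [Field K] [CharZero K] (i j p q : Fin 3) (hij : i ≠ j)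
    (h : auxD K p - auxD K q = auxD K i - auxD K j) : p = i ∧ q = j := by
  fin_cases i <;> fin_cases j <;> first | exact absurd rfl hij | skip
  all_goals
    fin_cases p <;> fin_cases q <;> first | exact ⟨rfl, rfl⟩ | (exfalso; norm_num [auxD] at h)

lemma aux_diag_lie {K : Type*} [Field K] (d : Fin 3 → K) (x : Matrix (Fin 3) (Fin 3) K)
    (p q : Fin 3) : ⁅Matrix.diagonal d, x⁆ p q = (d p - d q) * x p q := by
  rw [Ring.lie_def, Matrix.sub_apply, Matrix.diagonal_mul, Matrix.mul_diagonal]; ring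

lemma aux_proj {K : Type*} [Field K] [CharZero K]
    (M : LieSubalgebra K (Matrix (Fin 3) (Fin 3) K))
    (hD : Matrix.diagonal (auxD K) ∈ M) {x : Matrix (Fin 3) (Fin 3) K} (hx : x ∈ M)
    (i j : Fin 3) (hij : i ≠ j) (hxij : x i j ≠ 0) : Matrix.single i j (1 : K) ∈ M := by
  have step : ∀ s : Finset (Fin 3 × Fin 3), ∃ y ∈ M, ∀ p q, y p q =
      (∏ r ∈ s, ((auxD K p - auxD K q) - (auxD K r.1 - auxD K r.2))) * x p q := by
    intro s
    induction s using Finset.induction_on with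
    | empty => exact ⟨x, hx, by simp⟩
    | insert r s hr ih =>
      obtain ⟨y, hy, hy2⟩ := ih
      refine ⟨⁅Matrix.diagonal (auxD K), y⁆ - (auxD K r.1 - auxD K r.2) • y,
        sub_mem (M.lie_mem hD hy) (M.smul_mem _ hy), fun p q => ?_⟩
      rw [Matrix.sub_apply, aux_diag_lie, Matrix.smul_apply, hy2, Finset.prod_insert hr,
        smul_eq_mul]
      ring
  obtain ⟨y, hy, hy2⟩ := step (Finset.univ.erase (i, j))
  have hyij : y i j ≠ 0 := by
    rw [hy2]
    refine mul_ne_zero (Finset.prod_ne_zero_iff.mpr ?_) hxij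
    rintro ⟨p, q⟩ hr h0
    have := auxD_inj K i j p q hij (sub_eq_zero.mp h0).symm
    simp [this.1, this.2] at hr
  have hyE : Matrix.single i j (1 : K) = (y i j)⁻¹ • y := by
    ext p q
    by_cases hpq : p = i ∧ q = j
    · obtain ⟨rfl, rfl⟩ := hpq
      simp [hyij]
    · have : y p q = 0 := by
        rw [hy2, Finset.prod_eq_zero (i := (p, q)), zero_mul]
        · simpa using hpq
        · ring
      rw [Matrix.smul_apply, this, Matrix.single_apply_of_ne]
      · simp
      · rintro ⟨rfl, rfl⟩; exact hpq ⟨rfl, rfl⟩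
  rw [hyE]
  exact M.smul_mem _ hy

lemma aux_rank_two {K L V : Type*} [Field K] [IsAlgClosed K] [CharZero K] [LieRing L]
    [LieAlgebra K L] [FiniteDimensional K L] [IsKilling K L]
    (H : LieSubalgebra K L) [H.IsCartanSubalgebra]
    [AddCommGroup V] [Module K V] [FiniteDimensional K V] [LieRingModule L V] [LieModule K L V]
    (hinj : Function.Injective (toEnd K L V))
    (b : Basis (Fin 3) K V) (χ : H →ₗ[K] (Fin 3 → K))
    (hb : ∀ (h : H) i, ⁅h, b i⁆ = χ h i • b i)
    (hχ : ∀ d : Fin 3 → K, d 0 + d 1 + d 2 = 0 → ∃ h, χ h = d) :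
    finrank K (sl (Fin 3) K) ≤ finrank K L := by
  let φ : L →ₗ⁅K⁆ Matrix (Fin 3) (Fin 3) K :=
    { (LinearMap.toMatrix b b).toLinearMap ∘ₗ (toEnd K L V : L →ₗ[K] Module.End K V) with
      map_lie' := by
        intro x y
        simp [Ring.lie_def, LinearMap.toMatrix_mul] }
  have hφ : ∀ x, φ x = LinearMap.toMatrix b b (toEnd K L V x) := fun x => rfl
  have hφinj : Function.Injective φ := fun x y hxy =>
    hinj ((LinearMap.toMatrix b b).injective hxy)
  have hφH : ∀ h : H, φ h = Matrix.diagonal (χ h) := by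
    intro h
    ext i j
    have h3 : (toEnd K L V h) (b j) = χ h j • b j := hb h j
    rw [hφ, LinearMap.toMatrix_apply, h3, Matrix.diagonal_apply]
    simp only [map_smul, Basis.repr_self, Finsupp.smul_apply, Finsupp.single_apply, smul_eq_mul]
    by_cases hij : i = j
    · subst hij; simp
    · simp [hij, Ne.symm hij]
  have hlieH : ∀ (h : H) (x : L) p q, φ ⁅(h : L), x⁆ p q = (χ h p - χ h q) * φ x p q := by
    intro h x p q
    rw [LieHom.map_lie, hφH, aux_diag_lie]
  let M := φ.range
  have hdiag : ∀ d : Fin 3 → K, d 0 + d 1 + d 2 = 0 → Matrix.diagonal d ∈ M := by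
    intro d hd
    obtain ⟨h, rfl⟩ := hχ d hd
    exact ⟨h, hφH h⟩
  have hD : Matrix.diagonal (auxD K) ∈ M := hdiag _ (auxD_sum K)
  obtain ⟨h0, hh0⟩ := hχ _ (auxD_sum K)
  -- symmetry
  have hsymm : ∀ i j : Fin 3, i ≠ j → Matrix.single i j (1 : K) ∈ M →
      Matrix.single j i (1 : K) ∈ M := by
    rintro i j hij ⟨x, hx'⟩
    have hx : φ x = Matrix.single i j 1 := hx'
    let α : H → K := fun h => χ h i - χ h j
    have hxα : ∀ h : H, ⁅(h : L), x⁆ = α h • x := by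
      intro h
      apply hφinj
      ext p q
      rw [hlieH, map_smul, Matrix.smul_apply, hx]
      by_cases hpq : i = p ∧ j = q
      · obtain ⟨rfl, rfl⟩ := hpq; rfl
      · rw [Matrix.single_apply_of_ne _ _ _ _ _ hpq]; simp
    have hxroot : x ∈ rootSpace H α :=
      (mem_genWeightSpace L α x).mpr fun h ↦ ⟨1, by
        have : ⁅h, x⁆ = α h • x := hxα h
        simp [this]⟩
    have hx0 : x ≠ 0 := by
      rintro rfl
      rw [map_zero] at hx
      have := congrFun (congrFun hx i) j
      simp at this
    let w : Weight K H L := ⟨α, fun hbot => hx0 (by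
      have h' : x ∈ genWeightSpace L α := hxroot
      rw [hbot] at h'
      simpa using h')⟩
    have hw : w.IsNonZero := by
      intro hz
      have h1 : α h0 = 0 := congrFun hz h0
      simp only [α, hh0] at h1
      have := auxD_inj K i j i i hij (by rw [h1, sub_self])
      exact hij this.2
    obtain ⟨_, e, f, t, he, hf⟩ := IsKilling.exists_isSl2Triple_of_weight_isNonZero hw
    have hf0 := t.f_ne_zero
    have hfw := IsKilling.lie_eq_smul_of_mem_rootSpace hf h0
    have hzero : ∀ p q, ¬ (p = j ∧ q = i) → φ f p q = 0 := by
      intro p q hpq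
      have h1 := hlieH h0 f p q
      have hfw' : ⁅(h0 : L), f⁆ = (-(α h0)) • f := hfw
      rw [hfw', map_smul, Matrix.smul_apply, hh0, smul_eq_mul] at h1
      simp only [α, hh0] at h1
      by_contra hne
      have h2 := mul_right_cancel₀ hne h1
      exact hpq (auxD_inj K j i p q hij.symm (by rw [← h2]; ring))
    refine aux_proj M hD (x := φ f) ⟨f, rfl⟩ j i hij.symm fun h1 => hf0 ?_
    apply hφinj
    rw [map_zero]
    ext p q
    by_cases hpq : p = j ∧ q = i
    · rw [hpq.1, hpq.2, h1]; rfl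
    · rw [hzero p q hpq]; rfl
  -- no isolated index
  have hiso : ∀ i : Fin 3, ∃ j, j ≠ i ∧ Matrix.single i j (1 : K) ∈ M := by
    intro i
    by_contra! hcon
    obtain ⟨z, hz⟩ := hχ (fun p => if p = i then -2 else 1) (by
      fin_cases i <;> simp [Fin.ext_iff] <;> norm_num)
    have hrow : ∀ (y : L) j, j ≠ i → φ y i j = 0 := fun y j hj => by
      by_contra hne
      exact hcon j hj (aux_proj M hD ⟨y, rfl⟩ i j hj.symm hne)
    have hcol : ∀ (y : L) j, j ≠ i → φ y j i = 0 := fun y j hj => by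
      by_contra hne
      exact hcon j hj (hsymm _ _ hj (aux_proj M hD ⟨y, rfl⟩ j i hj hne))
    have hcent : (z : L) ∈ LieAlgebra.center K L := by
      rw [LieModule.mem_maxTrivSubmodule]
      intro y
      rw [← lie_skew, neg_eq_zero]
      apply hφinj
      rw [map_zero]
      ext p q
      rw [hlieH, hz]
      by_cases hp : p = i
      · by_cases hq : q = i
        · simp [hp, hq]
        · rw [hp, hrow y q hq]; simp
      · by_cases hq : q = i
        · rw [hq, hcol y p hp]; simp
        · simp [hp, hq]
    rw [LieAlgebra.center_eq_bot] at hcent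
    have hz0 : z = 0 := by
      apply Subtype.ext
      simpa using hcent
    rw [hz0, map_zero] at hz
    have := congrFun hz i
    simp at this
  have htrans : ∀ i j k : Fin 3, i ≠ k → Matrix.single i j (1 : K) ∈ M →
      Matrix.single j k (1 : K) ∈ M → Matrix.single i k (1 : K) ∈ M := by
    intro i j k hik h1 h2
    have := M.lie_mem h1 h2
    rw [Ring.lie_def, Matrix.single_mul_single_same, Matrix.single_mul_single_of_ne] at this
    · simpa using this
    · exact hik.symm
  have hall : ∀ i j : Fin 3, i ≠ j → Matrix.single i j (1 : K) ∈ M := by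
    intro i j hij
    by_contra hne
    obtain ⟨k, hk, hik⟩ := hiso i
    obtain ⟨l, hl, hjl⟩ := hiso j
    have hkj : k ≠ j := by rintro rfl; exact hne hik
    have hli : l ≠ i := by rintro rfl; exact hne (hsymm _ _ hij.symm hjl)
    have hkl : k = l := by
      revert i j k l
      clear * -
      intro i j _ _ k _ _ l _ _ _ _
      omega
    subst hkl
    exact hne (htrans i k j hij hik (hsymm _ _ hkj.symm hjl))
  have hle : (sl (Fin 3) K).toSubmodule ≤ LinearMap.range (φ : L →ₗ[K] _) := by
    intro A hA
    have htr : A.trace = 0 := hA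
    rw [Matrix.trace_fin_three] at htr
    change A ∈ M
    have hdec : A = Matrix.diagonal (fun i => A i i) + (A 0 1 • Matrix.single 0 1 1 +
      A 0 2 • Matrix.single 0 2 1 + A 1 0 • Matrix.single 1 0 1 + A 1 2 • Matrix.single 1 2 1 +
      A 2 0 • Matrix.single 2 0 1 + A 2 1 • Matrix.single 2 1 1) := by
      ext p q
      fin_cases p <;> fin_cases q <;> simp [Matrix.single_apply]
    rw [hdec]
    refine add_mem (hdiag _ htr) ?_
    repeat' apply add_mem
    all_goals exact M.smul_mem _ (hall _ _ (by decide))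
  have h1 := Submodule.finrank_mono hle
  rw [LinearMap.finrank_range_of_inj hφinj] at h1
  exact h1

lemma aux_finrank_sl (K : Type*) [Field K] (n : ℕ) (hn : 0 < n) :
    finrank K (sl (Fin n) K) + 1 = n * n := by
  have h1 := LinearMap.finrank_range_add_finrank_ker (Matrix.traceLinearMap (Fin n) K K)
  have hs : Function.Surjective (Matrix.traceLinearMap (Fin n) K K) := by
    apply LinearMap.surjective
    intro h0
    have := LinearMap.congr_fun h0 (Matrix.single ⟨0, hn⟩ ⟨0, hn⟩ 1)
    simp at this
  rw [LinearMap.range_eq_top.mpr hs, finrank_top, finrank_self, finrank_matrix] at h1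
  have h2 : finrank K (sl (Fin n) K) =
    finrank K (LinearMap.ker (Matrix.traceLinearMap (Fin n) K K)) := rfl
  simp at h1
  omega

lemma aux_main (K : Type*) [Field K] [IsAlgClosed K] [CharZero K]
    (L : LieSubalgebra K ↥(sl (Fin 3) K))
    (hss : LieAlgebra.HasTrivialRadical K ↥L) :
    L = ⊥ ∨ Nonempty (↥L ≃ₗ⁅K⁆ ↥(sl (Fin 2) K)) ∨ L = ⊤ := by
  haveI := hss
  haveI : IsKilling K L := inferInstance
  obtain ⟨x, hx⟩ := LieAlgebra.exists_isCartanSubalgebra_engel K L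
  have hto : ∀ y : L, toEnd K L (Fin 3 → K) y = Matrix.toLin' y.1.1 := fun y => rfl
  have hinj : Function.Injective (toEnd K L (Fin 3 → K)) := by
    intro y z hyz
    rw [hto, hto] at hyz
    exact Subtype.ext (Subtype.ext (Matrix.toLin'.injective hyz))
  have htr : ∀ y : L, LinearMap.trace K (Fin 3 → K) (toEnd K L (Fin 3 → K) y) = 0 := by
    intro y
    rw [hto, Matrix.trace_toLin'_eq]
    exact y.1.2
  obtain ⟨h2, h3⟩ := aux_eigenbasis (LieSubalgebra.engel K x) hinj htr (by simp)
  have h4 : finrank K (LieSubalgebra.engel K x) = 0 ∨ finrank K (LieSubalgebra.engel K x) = 1 ∨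
    finrank K (LieSubalgebra.engel K x) = 2 := by omega
  rcases h4 with h4 | h4 | h4
  · left
    have hb : (LieSubalgebra.engel K x) = ⊥ := by
      rw [← LieSubalgebra.toSubmodule_inj]
      exact Submodule.finrank_eq_zero.mp h4
    have hn := hx.self_normalizing
    rw [LieSubalgebra.eq_bot_iff] at hb ⊢
    intro y hy
    have := hb x (LieSubalgebra.self_mem_engel K x)
    have hy' : (⟨y, hy⟩ : L) ∈ LieSubalgebra.engel K x := by
      rw [LieSubalgebra.mem_engel_iff]
      exact ⟨1, by simp [this]⟩
    exact congrArg Subtype.val (hb _ hy')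
  · exact Or.inr (Or.inl (aux_rank_one _ h4))
  · right; right
    obtain ⟨b, χ, hb, hχ⟩ := h3 h4
    have h5 := aux_rank_two (LieSubalgebra.engel K x) hinj b χ hb hχ
    rw [← LieSubalgebra.toSubmodule_inj]
    exact Submodule.eq_top_of_finrank_eq (le_antisymm (Submodule.finrank_le _) h5)

lemma aux_excl (K : Type*) [Field K] (L : LieSubalgebra K ↥(sl (Fin 3) K)) :
    (L = ⊥ → finrank K L = 0) ∧ (Nonempty (↥L ≃ₗ⁅K⁆ ↥(sl (Fin 2) K)) → finrank K L = 3) ∧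
    (L = ⊤ → finrank K L = 8) := by
  refine ⟨?_, ?_, ?_⟩
  · rintro rfl
    exact finrank_bot K _
  · rintro ⟨e⟩
    have h1 := e.toLinearEquiv.finrank_eq
    have h2 := aux_finrank_sl K 2 (by norm_num)
    omega
  · rintro rfl
    have h1 := finrank_top K ↥(sl (Fin 3) K)
    have h2 := aux_finrank_sl K 3 (by norm_num)
    have h3 : finrank K (⊤ : LieSubalgebra K ↥(sl (Fin 3) K)) = finrank K ↥(sl (Fin 3) K) := h1
    omega

end SL3Aux

open LieAlgebra.SpecialLinear

/-- **Classification of semisimple Lie subalgebras of `sl(3)` over an algebraically closed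
field of characteristic zero.**  If `L` is a Lie subalgebra of `sl(3,K)` which is semisimple
(i.e. has no nonzero solvable ideals), then exactly one of the following holds:
`L = 0`, `L ≅ sl(2,K)`, or `L = sl(3,K)`. -/
theorem semisimple_subalgebra_sl3_trichotomy
    (K : Type*) [Field K] [IsAlgClosed K] [CharZero K]
    (L : LieSubalgebra K ↥(sl (Fin 3) K))
    (hss : LieAlgebra.HasTrivialRadical K ↥L) :
    (L = ⊥ ∧ ¬ Nonempty (↥L ≃ₗ⁅K⁆ ↥(sl (Fin 2) K)) ∧ L ≠ ⊤) ∨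
    (L ≠ ⊥ ∧ Nonempty (↥L ≃ₗ⁅K⁆ ↥(sl (Fin 2) K)) ∧ L ≠ ⊤) ∨
    (L ≠ ⊥ ∧ ¬ Nonempty (↥L ≃ₗ⁅K⁆ ↥(sl (Fin 2) K)) ∧ L = ⊤) := by
  obtain ⟨h0, h3, h8⟩ := aux_excl K L
  rcases aux_main K L hss with h | h | h
  · have := h0 h
    exact Or.inl ⟨h, fun h' => by have := h3 h'; omega, fun h' => by have := h8 h'; omega⟩
  · have := h3 h
    exact Or.inr (Or.inl ⟨fun h' => by have := h0 h'; omega, h, fun h' => by have := h8 h'; omega⟩)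
  · have := h8 h
    exact Or.inr (Or.inr ⟨fun h' => by have := h0 h'; omega, fun h' => by have := h3 h'; omega, h⟩)
end

section
/- Let k be a field of characteristic zero and let L be a Lie subalgebra of sl(3,k) (the Lie algebra of trace-zero 3×3 matrices over k under the commutator bracket) which is semisimple as a Lie algebra. Then exactly one of the following holds: (1) L is the zero subalgebra; (2) L has dimension 3 over k and the base change k̄ ⊗_k L to an algebraic closure k̄ of k is isomorphic, as a Lie algebra over k̄, to sl(2,k̄) (i.e. L is a form of sl(2,k)); (3) L equals sl(3,k). -/
open LieAlgebra.SpecialLinear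
open scoped TensorProduct

section helpers
open LieAlgebra LieModule Module
set_option linter.unusedSectionVars false

section core
variable {K A V : Type*} [Field K] [CharZero K] [IsAlgClosed K]
  [LieRing A] [LieAlgebra K A] [FiniteDimensional K A] [LieAlgebra.IsKilling K A]
  [AddCommGroup V] [Module K V] [LieRingModule A V] [LieModule K A V] [FiniteDimensional K V]

lemma sl3aux_nilp (H : LieSubalgebra K A) [H.IsCartanSubalgebra]
    (hf : Function.Injective (toEnd K A V)) {x : A} (hx : x ∈ H)
    (hn : _root_.IsNilpotent (toEnd K A V x)) : x = 0 := by
  letI i0 : LieRing (End K V) := LieRing.ofAssociativeRing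
  apply LieAlgebra.IsKilling.eq_zero_of_isNilpotent_ad_of_mem_isCartanSubalgebra K A H hx
  obtain ⟨n, hn⟩ := LieAlgebra.ad_nilpotent_of_nilpotent (R := K) hn
  refine ⟨n, ?_⟩
  have key : ∀ (m : ℕ) (y : A), toEnd K A V (((ad K A x) ^ m) y) =
      ((ad K (End K V) (toEnd K A V x)) ^ m) (toEnd K A V y) := by
    intro m
    induction m with
    | zero => intro y; simp
    | succ m ih =>
      intro y
      rw [pow_succ, pow_succ, Module.End.mul_apply, Module.End.mul_apply, ih]
      congr 1
      simp
  ext y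
  apply hf
  rw [key, hn]
  simp

lemma sl3aux_trace (H : LieSubalgebra K A) [H.IsCartanSubalgebra] (h : H) :
    LinearMap.trace K V (toEnd K A V (h : A)) =
      ∑ χ : Weight K H V, finrank K (genWeightSpace V χ) • χ h := by
  have hxy : ∀ χ : Weight K H V, Set.MapsTo (toEnd K H V h)
      (genWeightSpace V χ) (genWeightSpace V χ) :=
    fun χ m hm ↦ LieSubmodule.lie_mem _ hm
  classical
  have hds := DirectSum.isInternal_submodule_of_iSupIndep_of_iSup_eq_top
    (LieSubmodule.iSupIndep_toSubmodule.mpr <| iSupIndep_genWeightSpace' K H V)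
    (LieSubmodule.iSup_toSubmodule_eq_top.mpr <| iSup_genWeightSpace_eq_top' K H V)
  have h1 : toEnd K A V (h : A) = toEnd K H V h := rfl
  rw [h1, LinearMap.trace_eq_sum_trace_restrict hds hxy]
  refine Finset.sum_congr rfl fun χ _ => ?_
  rw [← trace_toEnd_genWeightSpace]
  rfl

lemma sl3aux_eq_zero (H : LieSubalgebra K A) [H.IsCartanSubalgebra]
    (hf : Function.Injective (toEnd K A V)) (h : H)
    (hz : ∀ χ : Weight K H V, χ h = 0) : h = 0 := by
  have : (h : A) = 0 := by
    apply sl3aux_nilp (V := V) H hf h.2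
    have h1 : toEnd K A V (h : A) = toEnd K H V h := rfl
    rw [h1]
    suffices hT : (toEnd K H V h).maxGenEigenspace 0 = ⊤ by
      refine ⟨finrank K V, ?_⟩
      rw [Module.End.maxGenEigenspace_eq_genEigenspace_finrank, Module.End.genEigenspace_nat,
        LinearMap.ker_eq_top] at hT
      simpa using hT
    rw [eq_top_iff, ← LieSubmodule.iSup_toSubmodule_eq_top.mpr (iSup_genWeightSpace_eq_top' K H V)]
    refine iSup_le fun χ => ?_
    have := genWeightSpace_le_genWeightSpaceOf V h χ
    rw [hz χ] at this
    exact this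
  exact_mod_cast this

lemma sl3aux_basis (H : LieSubalgebra K A) [H.IsCartanSubalgebra]
    (hf : Function.Injective (toEnd K A V)) (hV : finrank K V = 3)
    (htr : ∀ x : A, LinearMap.trace K V (toEnd K A V x) = 0)
    (hH : 2 ≤ finrank K H) :
    ∃ b : Basis (Fin 3) K V, ∀ d : Fin 3 → K, d 0 + d 1 + d 2 = 0 →
      ∃ h : H, ∀ i, ⁅(h : A), b i⁆ = d i • b i := by
  classical
  have hw := fun χ : Weight K H V => exists_forall_lie_eq_smul K H V χ
  choose v hv0 hv using hw
  have hli : LinearIndependent K v := by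
    refine iSupIndep.linearIndependent (fun χ : Weight K H V => (genWeightSpace V χ).toSubmodule)
      (LieSubmodule.iSupIndep_toSubmodule.mpr <| iSupIndep_genWeightSpace' K H V) (fun χ => ?_) hv0
    exact weightSpace_le_genWeightSpace V χ ((mem_weightSpace _ _).2 (hv χ))
  have hle : Fintype.card (Weight K H V) ≤ 3 := hV ▸ hli.fintype_card_le_finrank
  have hrel : ∀ h : H, ∑ χ : Weight K H V, finrank K (genWeightSpace V χ) • χ h = 0 := by
    intro h; rw [← sl3aux_trace, htr]
  have hcard : Fintype.card (Weight K H V) = 3 := by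
    by_contra hne
    have hlt : Fintype.card (Weight K H V) ≤ 2 := by omega
    by_cases hE : Nonempty (Weight K H V)
    · obtain ⟨χ₀⟩ := hE
      -- map to the other weights is injective
      let F : H →ₗ[K] ({χ : Weight K H V // χ ≠ χ₀} → K) :=
        LinearMap.pi fun χ => Weight.toLinear K H V χ.1
      have hF : Function.Injective F := by
        rw [← LinearMap.ker_eq_bot, LinearMap.ker_eq_bot']
        intro h hh
        have h1 : ∀ χ : Weight K H V, χ ≠ χ₀ → χ h = 0 := fun χ hχ => congrFun hh ⟨χ, hχ⟩
        apply sl3aux_eq_zero (V := V) H hf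
        intro χ
        by_cases hχ : χ = χ₀
        · subst hχ
          have := hrel h
          rw [Finset.sum_eq_single χ (fun b _ hb => by rw [h1 b hb, smul_zero]) (by simp)] at this
          have hpos := zero_lt_finrank_genWeightSpace χ.genWeightSpace_ne_bot
          rw [nsmul_eq_mul, mul_eq_zero] at this
          rcases this with h | h
          · exact absurd (Nat.cast_eq_zero.1 h) hpos.ne'
          · exact h
        · exact h1 χ hχ
      have := LinearMap.finrank_le_finrank_of_injective hF
      rw [Module.finrank_fintype_fun_eq_card, Fintype.card_subtype_compl,
        Fintype.card_subtype_eq] at this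
      omega
    · have : Nontrivial H := Module.nontrivial_of_finrank_pos (R := K) (by omega)
      obtain ⟨h, hh⟩ := exists_ne (0 : H)
      exact hh (sl3aux_eq_zero (V := V) H hf h fun χ => absurd ⟨χ⟩ hE)
  let e : Weight K H V ≃ Fin 3 := Fintype.equivFinOfCardEq hcard
  have : Nonempty (Weight K H V) := Fintype.card_pos_iff.1 (by omega)
  let b0 : Basis (Weight K H V) K V := 
    basisOfLinearIndependentOfCardEqFinrank hli
      (by rw [hcard, hV])
  let b := b0.reindex e
  have hb : ∀ i, b i = v (e.symm i) := by intro i; simp [b, b0]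
  have hbh : ∀ (h : H) i, ⁅(h : A), b i⁆ = (e.symm i) h • b i := by
    intro h i
    rw [hb]
    exact hv _ h
  have hsum : ∀ h : H, (e.symm 0) h + (e.symm 1) h + (e.symm 2) h = 0 := by
    intro h
    have h1 := htr h
    rw [LinearMap.trace_eq_matrix_trace K b, Matrix.trace_fin_three] at h1
    simpa [LinearMap.toMatrix_apply, hbh] using h1
  let F : H →ₗ[K] (Fin 2 → K) :=
    LinearMap.pi fun i => Weight.toLinear K H V (e.symm i.castSucc)
  have hF : Function.Injective F := by
    rw [← LinearMap.ker_eq_bot, LinearMap.ker_eq_bot']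
    intro h hh
    have h0 : (e.symm 0) h = 0 := congrFun hh 0
    have h1 : (e.symm 1) h = 0 := congrFun hh 1
    have h2 : (e.symm 2) h = 0 := by simpa [h0, h1] using hsum h
    apply sl3aux_eq_zero (V := V) H hf
    intro χ
    obtain ⟨i, rfl⟩ := e.symm.surjective χ
    fin_cases i <;> assumption
  have hFs : Function.Surjective F := by
    rw [← LinearMap.injective_iff_surjective_of_finrank_eq_finrank]
    · exact hF
    · have := LinearMap.finrank_le_finrank_of_injective hF
      simp at this ⊢
      omega
  refine ⟨b, fun d hd => ?_⟩
  obtain ⟨h, hh⟩ := hFs ![d 0, d 1]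
  have h0 : (e.symm 0) h = d 0 := congrFun hh 0
  have h1 : (e.symm 1) h = d 1 := congrFun hh 1
  have h2 : (e.symm 2) h = d 2 := by
    have := hsum h
    rw [h0, h1] at this
    linear_combination this - hd
  refine ⟨h, fun i => ?_⟩
  rw [hbh]
  fin_cases i <;> simp [h0, h1, h2]

end core

section core2
variable {K A V : Type*} [Field K] [CharZero K] [IsAlgClosed K]
  [LieRing A] [LieAlgebra K A] [FiniteDimensional K A] [LieAlgebra.IsKilling K A]
  [AddCommGroup V] [Module K V] [LieRingModule A V] [LieModule K A V] [FiniteDimensional K V]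

/-- The matrix of the action of `x` in the basis `b`. -/
noncomputable def sl3aux_mat (b : Basis (Fin 3) K V) : A →ₗ[K] Matrix (Fin 3) (Fin 3) K where
  toFun x := LinearMap.toMatrix b b (toEnd K A V x)
  map_add' x y := by rw [← map_add (LinearMap.toMatrix b b)]; congr 1; ext v; simp
  map_smul' c x := by
    rw [RingHom.id_apply, ← map_smul (LinearMap.toMatrix b b)]; congr 1; ext v; simp

lemma sl3aux_mat_lie (b : Basis (Fin 3) K V) (x y : A) :
    sl3aux_mat b ⁅x, y⁆ =
      sl3aux_mat b x * sl3aux_mat b y - sl3aux_mat b y * sl3aux_mat b x := by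
  have : toEnd K A V ⁅x, y⁆ = toEnd K A V x * toEnd K A V y - toEnd K A V y * toEnd K A V x := by
    ext v; simp
  change LinearMap.toMatrix b b (toEnd K A V ⁅x, y⁆) = _
  rw [this, map_sub, LinearMap.toMatrix_mul, LinearMap.toMatrix_mul]
  rfl

lemma sl3aux_mat_diag (b : Basis (Fin 3) K V) (x : A) (d : Fin 3 → K)
    (hx : ∀ i, ⁅x, b i⁆ = d i • b i) : sl3aux_mat b x = Matrix.diagonal d := by
  ext i j
  change LinearMap.toMatrix b b (toEnd K A V x) i j = _
  rw [LinearMap.toMatrix_apply, toEnd_apply_apply, hx, map_smul, b.repr_self, Matrix.diagonal_apply]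
  by_cases h : i = j
  · subst h; simp
  · simp [h, Finsupp.single_apply, Ne.symm h]

lemma sl3aux_mat_eigen (b : Basis (Fin 3) K V) (h x : A) (d : Fin 3 → K)
    (hh : sl3aux_mat b h = Matrix.diagonal d) (c : K) (hx : ⁅h, x⁆ = c • x) (i j : Fin 3) :
    (d i - d j) * sl3aux_mat b x i j = c * sl3aux_mat b x i j := by
  have := congrArg (fun M => M i j) (sl3aux_mat_lie b h x)
  rw [hx, hh, map_smul] at this
  simp at this
  linear_combination -this

lemma sl3aux_all (H : LieSubalgebra K A) [H.IsCartanSubalgebra]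
    (hf : Function.Injective (toEnd K A V)) (b : Basis (Fin 3) K V)
    (hb : ∀ d : Fin 3 → K, d 0 + d 1 + d 2 = 0 →
      ∃ h : H, ∀ i, ⁅(h : A), b i⁆ = d i • b i) (i j : Fin 3) (hij : i ≠ j) :
    ∃ x : A, sl3aux_mat b x = Matrix.single i j 1 := by
  classical
  set ψ : A →ₗ[K] Matrix (Fin 3) (Fin 3) K := sl3aux_mat b with hψ
  have hinj : Function.Injective ψ := (LinearMap.toMatrix b b).injective.comp hf
  have hD : ∀ d : Fin 3 → K, d 0 + d 1 + d 2 = 0 → ∃ h : H, ψ h = Matrix.diagonal d := by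
    intro d hd
    obtain ⟨h, hh⟩ := hb d hd
    exact ⟨h, sl3aux_mat_diag b (h : A) d hh⟩
  -- a generic element
  let d : Fin 3 → K := ![-4, -1, 5]
  obtain ⟨t, ht⟩ := hD d (by simp [d]; norm_num)
  have hgen : ∀ i j i' j' : Fin 3, i ≠ j → d i - d j = d i' - d j' → i = i' ∧ j = j' := by
    intro i j i' j' hne h
    fin_cases i <;> fin_cases j <;> fin_cases i' <;> fin_cases j' <;>
      first
      | exact ⟨rfl, rfl⟩
      | exact absurd rfl hne
      | (exfalso; norm_num [d] at h)
  let P : Fin 3 → Fin 3 → Prop := fun i j => ∃ x : A, ψ x = Matrix.single i j 1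
  -- eigenvectors
  have heig : ∀ (x : A) (c : K), ⁅(t : A), x⁆ = c • x → ∀ i j, i ≠ j → ψ x i j ≠ 0 →
      ψ x = ψ x i j • Matrix.single i j 1 ∧ c = d i - d j := by
    intro x c hx i j hne hxij
    have h1 := sl3aux_mat_eigen b (t : A) x d ht c hx
    have hc : d i - d j = c := mul_right_cancel₀ hxij (h1 i j)
    refine ⟨?_, hc.symm⟩
    ext i' j'
    by_cases hh : i = i' ∧ j = j'
    · obtain ⟨rfl, rfl⟩ := hh; simp
    · have h2 := h1 i' j'
      rw [← hc] at h2
      have : ψ x i' j' = 0 := by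
        by_contra h0
        exact hh (hgen i j i' j' hne (mul_right_cancel₀ h0 h2).symm)
      rw [this, Matrix.smul_apply, Matrix.single_apply_of_ne _ _ _ _ _ hh, smul_zero]
  have hP : ∀ (x : A) (c : K), ⁅(t : A), x⁆ = c • x → ∀ i j, i ≠ j → ψ x i j ≠ 0 → P i j := by
    intro x c hx i j hne hxij
    refine ⟨(ψ x i j)⁻¹ • x, ?_⟩
    rw [map_smul]
    conv_lhs => rw [(heig x c hx i j hne hxij).1]
    rw [smul_smul]
    simp [hxij]
  have ha : ∀ i j, i ≠ j → ¬ P i j → ∀ x : A, ψ x i j = 0 := by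
    intro i j hne hnP x
    let W : Submodule K A := LinearMap.ker ((Matrix.entryLinearMap K K i j) ∘ₗ ψ)
    have hW : W = ⊤ := by
      rw [eq_top_iff,
        ← LieSubmodule.iSup_toSubmodule_eq_top.mpr (iSup_genWeightSpace_eq_top' K H A)]
      refine iSup_le fun α y hy => ?_
      have hy' := LieAlgebra.IsKilling.lie_eq_smul_of_mem_rootSpace hy t
      change ψ y i j = 0
      by_contra h0
      exact hnP (hP y _ hy' i j hne h0)
    have : x ∈ W := hW ▸ Submodule.mem_top
    exact this
  have hneg : ∀ i j, i ≠ j → P i j → P j i := by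
    rintro i j hne ⟨x, hx⟩
    by_contra hn
    have hx0 : x ≠ 0 := by
      rintro rfl
      rw [map_zero] at hx
      simpa using congrArg (fun M => M i j) hx
    -- decompose
    have hroot : ∃ (α : Weight K H A) (y : A), y ∈ genWeightSpace A α ∧ ψ y i j ≠ 0 := by
      by_contra hcon
      push Not at hcon
      let W : Submodule K A := LinearMap.ker ((Matrix.entryLinearMap K K i j) ∘ₗ ψ)
      have hW : W = ⊤ := by
        rw [eq_top_iff,
          ← LieSubmodule.iSup_toSubmodule_eq_top.mpr (iSup_genWeightSpace_eq_top' K H A)]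
        exact iSup_le fun α y hy => hcon α y hy
      have : x ∈ W := hW ▸ Submodule.mem_top
      have h0 : ψ x i j = 0 := this
      rw [hx] at h0
      simp at h0
    obtain ⟨α, y, hy, hyij⟩ := hroot
    have hy' := LieAlgebra.IsKilling.lie_eq_smul_of_mem_rootSpace hy t
    have hc := (heig y _ hy' i j hne hyij).2
    obtain ⟨z, hz, hz0⟩ := (-α).exists_ne_zero
    have hz' : ⁅(t : A), z⁆ = _ := LieAlgebra.IsKilling.lie_eq_smul_of_mem_rootSpace hz t
    rw [Weight.coe_neg, Pi.neg_apply, hc] at hz'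
    have h1 := sl3aux_mat_eigen b (t : A) z d ht _ hz'
    apply hz0
    apply hinj
    rw [map_zero]
    ext i' j'
    by_cases hh : j = i' ∧ i = j'
    · obtain ⟨rfl, rfl⟩ := hh
      exact ha _ _ hne.symm hn z
    · by_contra h0
      exact hh (hgen j i i' j' hne.symm
        (by rw [mul_right_cancel₀ h0 (h1 i' j')]; ring))
  have htrans : ∀ i j l, i ≠ l → P i j → P j l → P i l := by
    rintro i j l hil ⟨x, hx⟩ ⟨y, hy⟩
    refine ⟨⁅x, y⁆, ?_⟩
    rw [hψ, sl3aux_mat_lie, ← hψ, hx, hy]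
    simp [hil.symm]
  have hex : ∀ i, ∃ j, i ≠ j ∧ P i j := by
    intro i
    by_contra hcon
    push Not at hcon
    have hr : ∀ j, i ≠ j → ∀ x, ψ x i j = 0 := fun j hj => ha i j hj (hcon j hj)
    have hc : ∀ j, i ≠ j → ∀ x, ψ x j i = 0 := fun j hj =>
      ha j i hj.symm fun h => hcon j hj (hneg j i hj.symm h)
    obtain ⟨h, hh⟩ := hD (fun j => if j = i then -2 else 1) (by
      fin_cases i <;> simp <;> norm_num)
    have hcen : (h : A) ∈ LieAlgebra.center K A := by
      rw [LieModule.mem_maxTrivSubmodule]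
      intro x
      apply hinj
      rw [map_zero, hψ, sl3aux_mat_lie, ← hψ, hh]
      ext p q
      simp only [Matrix.sub_apply, Matrix.mul_diagonal, Matrix.diagonal_mul, Matrix.zero_apply]
      by_cases hp : p = i <;> by_cases hq : q = i
      · simp [hp, hq]; ring
      · subst hp; rw [hr q (Ne.symm hq)]; simp
      · subst hq; rw [hc p (Ne.symm hp)]; simp
      · simp [hp, hq]
    rw [LieAlgebra.center_eq_bot, LieSubmodule.mem_bot] at hcen
    rw [hcen, map_zero] at hh
    have := congrArg (fun M => M i i) hh
    simp at this
  -- conclude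
  change P i j
  obtain ⟨l, hl⟩ : ∃ l, l ≠ i ∧ l ≠ j ∧ ∀ p, p = i ∨ p = j ∨ p = l := by
    revert i j; decide
  obtain ⟨hli, hlj, hall⟩ := hl
  obtain ⟨p, hp, hp'⟩ := hex i
  rcases hall p with rfl | rfl | rfl
  · exact absurd rfl hp
  · exact hp'
  · obtain ⟨q, hq, hq'⟩ := hex j
    rcases hall q with rfl | rfl | rfl
    · exact hneg _ _ hq hq'
    · exact absurd rfl hq
    · exact htrans _ _ _ hij hp' (hneg _ _ hq hq')

lemma sl3aux_finrank_sl {F : Type*} [Field F] :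
    finrank F (LinearMap.ker (Matrix.traceLinearMap (Fin 3) F F)) = 8 := by
  have h := LinearMap.finrank_range_add_finrank_ker (Matrix.traceLinearMap (Fin 3) F F)
  have hs : LinearMap.range (Matrix.traceLinearMap (Fin 3) F F) = ⊤ := by
    rw [LinearMap.range_eq_top]
    intro c
    exact ⟨Matrix.single 0 0 c, by simp⟩
  rw [hs, finrank_top, Module.finrank_self, Module.finrank_matrix] at h
  simp at h
  omega

lemma sl3aux_rank_two (H : LieSubalgebra K A) [H.IsCartanSubalgebra]
    (hf : Function.Injective (toEnd K A V)) (hV : finrank K V = 3)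
    (htr : ∀ x : A, LinearMap.trace K V (toEnd K A V x) = 0)
    (hH : 2 ≤ finrank K H) : 8 ≤ finrank K A := by
  obtain ⟨b, hb⟩ := sl3aux_basis H hf hV htr hH
  have hall := sl3aux_all H hf b hb
  have hle : LinearMap.ker (Matrix.traceLinearMap (Fin 3) K K) ≤
      LinearMap.range (sl3aux_mat (A := A) b) := by
    intro M hM
    have hM' : M 0 0 + M 1 1 + M 2 2 = 0 := by
      have : M.trace = 0 := hM
      rwa [Matrix.trace_fin_three] at this
    obtain ⟨h, hh⟩ := hb (fun i => M i i) hM'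
    have hd := sl3aux_mat_diag b (h : A) _ hh
    have hS : ∀ i j, i ≠ j → Matrix.single i j (M i j) ∈
        LinearMap.range (sl3aux_mat (A := A) b) := by
      intro i j hij
      obtain ⟨x, hx⟩ := hall i j hij
      exact ⟨M i j • x, by rw [map_smul, hx]; simp⟩
    have : M = Matrix.diagonal (fun i => M i i) + Matrix.single 0 1 (M 0 1) +
        Matrix.single 0 2 (M 0 2) + Matrix.single 1 0 (M 1 0) + Matrix.single 1 2 (M 1 2) +
        Matrix.single 2 0 (M 2 0) + Matrix.single 2 1 (M 2 1) := by
      ext i j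
      fin_cases i <;> fin_cases j <;> simp [Matrix.single_apply]
    rw [this]
    refine add_mem (add_mem (add_mem (add_mem (add_mem (add_mem ⟨h, hd⟩ ?_) ?_) ?_) ?_) ?_) ?_ <;>
      exact hS _ _ (by decide)
  have h1 := Submodule.finrank_mono hle
  rw [sl3aux_finrank_sl] at h1
  exact h1.trans (LinearMap.finrank_range_le _)

end core2

section core3
variable {K A : Type*} [Field K] [CharZero K] [IsAlgClosed K]
  [LieRing A] [LieAlgebra K A] [FiniteDimensional K A] [LieAlgebra.IsKilling K A]

lemma sl3aux_sl2_trace (M : sl (Fin 2) K) : M.val 1 1 = - M.val 0 0 := by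
  have : M.val.trace = 0 := M.2
  rw [Matrix.trace_fin_two] at this
  linear_combination this

/-- The Lie algebra homomorphism from `sl(2)` attached to an `sl(2)`-triple. -/
noncomputable def sl3aux_sl2Hom {h e f : A} (t : IsSl2Triple h e f) : sl (Fin 2) K →ₗ⁅K⁆ A where
  toFun M := M.val 0 0 • h + M.val 0 1 • e + M.val 1 0 • f
  map_add' M N := by
    have : ∀ i j, (M + N).val i j = M.val i j + N.val i j := fun _ _ => rfl
    simp only [this]; module
  map_smul' c M := by
    have : ∀ i j, (c • M).val i j = c * M.val i j := fun _ _ => rfl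
    simp only [this, RingHom.id_apply]; module
  map_lie' := by
    intro M N
    have h1 : ⁅e, h⁆ = -((2 : K) • e) := by rw [← lie_skew, t.lie_h_e_smul K]
    have h2 : ⁅f, h⁆ = (2 : K) • f := by rw [← lie_skew, t.lie_lie_smul_f K, neg_neg]
    have h3 : ⁅f, e⁆ = - h := by rw [← lie_skew, t.lie_e_f]
    simp only [sl_bracket, Matrix.sub_apply, Matrix.mul_apply, Fin.sum_univ_two,
      sl3aux_sl2_trace, lie_add, add_lie, lie_smul, smul_lie, lie_self, t.lie_e_f,
      t.lie_h_e_smul K, t.lie_lie_smul_f K, h1, h2, h3]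
    module

lemma sl3aux_sl2Hom_apply {h e f : A} (t : IsSl2Triple h e f) (M : sl (Fin 2) K) :
    sl3aux_sl2Hom t M = M.val 0 0 • h + M.val 0 1 • e + M.val 1 0 • f := rfl

lemma sl3aux_sl2Hom_injective {h e f : A} (t : IsSl2Triple h e f) :
    Function.Injective (sl3aux_sl2Hom (K := K) t) := by
  have : IsAddTorsionFree A := .of_isTorsionFree K A
  intro M N hMN
  rw [← sub_eq_zero, ← map_sub] at hMN
  rw [← sub_eq_zero]
  generalize M - N = M at hMN
  rw [sl3aux_sl2Hom_apply] at hMN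
  have h1 := congrArg (fun y => ⁅h, y⁆) hMN
  simp only [lie_add, lie_smul, lie_self, t.lie_h_e_smul K, t.lie_lie_smul_f K, lie_zero] at h1
  have h2 := congrArg (fun y => ⁅h, y⁆) h1
  simp only [lie_add, lie_smul, lie_self, t.lie_h_e_smul K, t.lie_lie_smul_f K, lie_zero,
    lie_neg] at h2
  have h01 : M.val 0 1 = 0 := by
    have : (8 * M.val 0 1) • e = 0 := by linear_combination (norm := module) (2 : K) • h1 + h2
    rcases smul_eq_zero.1 this with h | h
    · simpa using h
    · exact absurd h t.e_ne_zero
  have h10 : M.val 1 0 = 0 := by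
    have : (8 * M.val 1 0) • f = 0 := by linear_combination (norm := module) h2 - (2 : K) • h1
    rcases smul_eq_zero.1 this with h | h
    · simpa using h
    · exact absurd h t.f_ne_zero
  have h00 : M.val 0 0 = 0 := by
    rw [h01, h10] at hMN
    simpa [t.h_ne_zero] using hMN
  have h11 := sl3aux_sl2_trace M
  rw [h00, neg_zero] at h11
  ext i j
  fin_cases i <;> fin_cases j <;> simp [h00, h01, h10, h11]

lemma sl3aux_rank_one (H : LieSubalgebra K A) [H.IsCartanSubalgebra]
    (hH : finrank K H ≤ 1) :
    Subsingleton A ∨ Nonempty (A ≃ₗ⁅K⁆ sl (Fin 2) K) := by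
  have htop := LieSubmodule.toSubmodule_inj _ _ |>.2 (cartan_sup_iSup_rootSpace_eq_top H)
  by_cases hα : ∃ α : Weight K H A, α.IsNonZero
  · right
    obtain ⟨α, hα⟩ := hα
    obtain ⟨h, e, f, t, he, hf⟩ := IsKilling.exists_isSl2Triple_of_weight_isNonZero hα
    have hh := t.h_eq_coroot hα he hf
    have hc0 : IsKilling.coroot α ≠ 0 := by
      intro h0; rw [h0] at hh; exact t.h_ne_zero hh
    have hH1 : finrank K H = 1 := by
      have : Nontrivial H := ⟨_, _, hc0⟩
      have : 0 < finrank K H := Module.finrank_pos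
      omega
    have hspan := (finrank_eq_one_iff_of_nonzero' _ hc0).1 hH1
    have hsurj : Function.Surjective (sl3aux_sl2Hom (K := K) t) := by
      let R : Submodule K A := LinearMap.range (sl3aux_sl2Hom (K := K) t).toLinearMap
      have hR : ∀ a b c : K, a • h + b • e + c • f ∈ R := by
        intro a b c
        refine ⟨⟨!![a, b; c, -a], ?_⟩, ?_⟩
        · change Matrix.trace (!![a, b; c, -a] : Matrix (Fin 2) (Fin 2) K) = 0
          simp [Matrix.trace_fin_two]
        · change a • h + b • e + c • f = _
          rfl
      have hle : (⊤ : Submodule K A) ≤ R := by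
        rw [← LieSubmodule.top_toSubmodule (R := K) (L := H) (M := A), ← htop]
        simp only [LieSubmodule.sup_toSubmodule, LieSubmodule.iSup_toSubmodule]
        refine sup_le ?_ (iSup_le fun β => iSup_le fun hβ => ?_)
        · intro x hx
          obtain ⟨c, hc⟩ := hspan ⟨x, hx⟩
          have : x = c • h := by rw [hh]; exact (congrArg Subtype.val hc).symm
          rw [this]
          simpa using hR c 0 0
        · have hβα : (β : H → K) = (β (IsKilling.coroot α) / 2) • α := by
            ext x
            obtain ⟨c, rfl⟩ := hspan x
            have h2 := IsKilling.root_apply_coroot hα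
            have e1 : β (c • IsKilling.coroot α) = c * β (IsKilling.coroot α) :=
              map_smul (Weight.toLinear K H A β) c _
            have e2 : α (c • IsKilling.coroot α) = c * α (IsKilling.coroot α) :=
              map_smul (Weight.toLinear K H A α) c _
            rw [Pi.smul_apply, e1, e2, h2, smul_eq_mul]
            ring
          intro x hx
          rcases IsKilling.eq_neg_or_eq_of_eq_smul α β hβ _ hβα with rfl | rfl
          · obtain ⟨c, hc⟩ := (finrank_eq_one_iff_of_nonzero'
              (⟨f, hf⟩ : rootSpace H (-α : H → K)) (by simpa using t.f_ne_zero)).mp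
              (IsKilling.finrank_rootSpace_eq_one (-α) (by simpa using hα)) ⟨x, hx⟩
            have : x = c • f := (congrArg Subtype.val hc).symm
            rw [this]
            simpa using hR 0 0 c
          · obtain ⟨c, hc⟩ := (finrank_eq_one_iff_of_nonzero'
              (⟨e, he⟩ : rootSpace H β) (by simpa using t.e_ne_zero)).mp
              (IsKilling.finrank_rootSpace_eq_one β hα) ⟨x, hx⟩
            have : x = c • e := (congrArg Subtype.val hc).symm
            rw [this]
            simpa using hR 0 c 0
      intro x
      exact hle (Submodule.mem_top (x := x))
    exact ⟨(LieEquiv.ofBijective _ ⟨sl3aux_sl2Hom_injective t, hsurj⟩).symm⟩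
  · left
    push Not at hα
    have hHtop : ∀ x : A, x ∈ H := by
      intro x
      have hx : x ∈ (⊤ : LieSubmodule K H A) := LieSubmodule.mem_top x
      rw [← cartan_sup_iSup_rootSpace_eq_top H] at hx
      have : (⨆ α : Weight K H A, ⨆ (_ : α.IsNonZero), rootSpace H α) = ⊥ := by
        rw [eq_bot_iff]
        exact iSup_le fun α => iSup_le fun h => absurd (hα α) h
      rw [this, sup_bot_eq] at hx
      exact hx
    have hab : IsLieAbelian A := ⟨fun x y => by
      have := LieModule.IsTrivial.trivial (⟨x, hHtop x⟩ : H) (⟨y, hHtop y⟩ : H)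
      exact congrArg Subtype.val this⟩
    exact (LieAlgebra.IsKilling.isLieAbelian_iff_subsingleton K A).1 hab

end core3

section base
variable {k K L : Type*} [Field k] [Field K] [Algebra k K]
  [LieRing L] [LieAlgebra k L] [FiniteDimensional k L]

lemma sl3aux_isKilling_baseChange [LieAlgebra.IsKilling k L] :
    LieAlgebra.IsKilling K (K ⊗[k] L) := by
  classical
  let b := Module.finBasis k L
  have h0 : (killingForm k L).Nondegenerate := LieAlgebra.IsKilling.killingForm_nondegenerate k L
  have h1 := (LinearMap.BilinForm.nondegenerate_iff_det_ne_zero b).1 h0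
  have h2 : killingForm K (K ⊗[k] L) = (killingForm k L).baseChange K :=
    traceForm_baseChange (R := k) (L := L) (M := L) K
  have h3 : LinearMap.BilinForm.toMatrix (b.baseChange K) (killingForm K (K ⊗[k] L)) =
      (LinearMap.BilinForm.toMatrix b (killingForm k L)).map (algebraMap k K) := by
    ext i j
    rw [h2]
    simp [LinearMap.BilinForm.toMatrix_apply, Algebra.algebraMap_eq_smul_one]
  have h4 : (killingForm K (K ⊗[k] L)).Nondegenerate := by
    refine (LinearMap.BilinForm.nondegenerate_iff_det_ne_zero (b.baseChange K)).2 ?_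
    rw [h3, ← RingHom.mapMatrix_apply, ← RingHom.map_det]
    simpa using h1
  constructor
  rw [← LieSubmodule.toSubmodule_inj]
  exact (LieIdeal.coe_killingCompl_top K (K ⊗[k] L)).trans
    (LinearMap.separatingLeft_iff_ker_eq_bot.1 h4.1)

end base

section final
variable {k : Type*} [Field k] [CharZero k] (K : Type*) [Field K] [Algebra k K]

/-- The `k`-linear embedding of `L` into matrices over `K`. -/
noncomputable def sl3aux_psi (L : LieSubalgebra k (sl (Fin 3) k)) :
    L →ₗ[k] Matrix (Fin 3) (Fin 3) K where
  toFun x := x.val.val.map (algebraMap k K)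
  map_add' x y := by
    ext i j
    exact map_add (algebraMap k K) _ _
  map_smul' c x := by
    ext i j
    change algebraMap k K (c * x.val.val i j) = c • algebraMap k K (x.val.val i j)
    rw [map_mul, Algebra.smul_def]

noncomputable def sl3aux_phi (L : LieSubalgebra k (sl (Fin 3) k)) :
    K ⊗[k] L →ₗ[K] Matrix (Fin 3) (Fin 3) K :=
  (sl3aux_psi K L).liftBaseChange K

lemma sl3aux_phi_tmul (L : LieSubalgebra k (sl (Fin 3) k)) (a : K) (x : L) :
    sl3aux_phi K L (a ⊗ₜ x) = a • x.val.val.map (algebraMap k K) := by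
  simp [sl3aux_phi]; rfl

lemma sl3aux_phi_injective (L : LieSubalgebra k (sl (Fin 3) k)) :
    Function.Injective (sl3aux_phi K L) := by
  let ι : L →ₗ[k] Matrix (Fin 3) (Fin 3) k :=
    { toFun := fun x => x.val.val, map_add' := fun _ _ => rfl, map_smul' := fun _ _ => rfl }
  have hι : Function.Injective ι := fun x y h => Subtype.ext (Subtype.ext h)
  have h1 := Module.Flat.lTensor_preserves_injective_linearMap (M := K) ι hι
  have h2 : ∀ z, sl3aux_phi K L z = (matrixEquivTensor (Fin 3) k K).symm (ι.lTensor K z) := by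
    intro z
    induction z with
    | zero => simp
    | add x y hx hy => simp only [map_add, hx, hy]
    | tmul a x =>
      rw [sl3aux_phi_tmul, LinearMap.lTensor_tmul, matrixEquivTensor_apply_symm]
      rfl
  intro x y h
  rw [h2, h2] at h
  exact h1 ((matrixEquivTensor (Fin 3) k K).symm.injective h)

lemma sl3aux_phi_trace (L : LieSubalgebra k (sl (Fin 3) k)) (z : K ⊗[k] L) :
    (sl3aux_phi K L z).trace = 0 := by
  induction z with
  | zero => simp
  | add x y hx hy => rw [map_add, Matrix.trace_add, hx, hy, add_zero]
  | tmul a x =>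
    have : x.val.val.trace = 0 := x.val.2
    rw [sl3aux_phi_tmul, Matrix.trace_smul, ← AddMonoidHom.map_trace (algebraMap k K), this]
    simp

lemma sl3aux_phi_lie (L : LieSubalgebra k (sl (Fin 3) k)) (z w : K ⊗[k] L) :
    sl3aux_phi K L ⁅z, w⁆ = sl3aux_phi K L z * sl3aux_phi K L w
      - sl3aux_phi K L w * sl3aux_phi K L z := by
  induction z with
  | zero =>
    have e : ⁅(0 : K ⊗[k] L), w⁆ = 0 := zero_lie w
    rw [e]; simp
  | add x y hx hy =>
    have e : ⁅x + y, w⁆ = ⁅x, w⁆ + ⁅y, w⁆ := add_lie x y w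
    rw [e, map_add, hx, hy, map_add]; noncomm_ring
  | tmul a x =>
    induction w with
    | zero =>
      have e : ⁅a ⊗ₜ[k] x, (0 : K ⊗[k] L)⁆ = 0 := lie_zero (a ⊗ₜ[k] x)
      rw [e]; simp
    | add y z hx hy =>
      have e : ⁅a ⊗ₜ[k] x, y + z⁆ = ⁅a ⊗ₜ[k] x, y⁆ + ⁅a ⊗ₜ[k] x, z⁆ := lie_add (a ⊗ₜ[k] x) y z
      rw [e, map_add, hx, hy, map_add]; noncomm_ring
    | tmul b y =>
      rw [LieAlgebra.ExtendScalars.bracket_tmul]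
      have hxy : (⁅x, y⁆ : L).val.val = x.val.val * y.val.val - y.val.val * x.val.val :=
        sl_bracket _ _ x.val y.val
      simp only [sl3aux_phi_tmul]
      rw [hxy]
      have h : ∀ M N : Matrix (Fin 3) (Fin 3) k, (M * N - N * M).map (algebraMap k K) =
          M.map (algebraMap k K) * N.map (algebraMap k K)
          - N.map (algebraMap k K) * M.map (algebraMap k K) := by
        intro M N
        simp only [← RingHom.mapMatrix_apply, map_sub, map_mul]
      rw [h]
      simp only [Matrix.smul_mul, Matrix.mul_smul, smul_smul, smul_sub, mul_comm b a]

lemma sl3aux_finrank_sl2 {F : Type*} [Field F] :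
    finrank F (LinearMap.ker (Matrix.traceLinearMap (Fin 2) F F)) = 3 := by
  have h := LinearMap.finrank_range_add_finrank_ker (Matrix.traceLinearMap (Fin 2) F F)
  have hs : Function.Surjective (Matrix.traceLinearMap (Fin 2) F F) := by
    intro c
    exact ⟨!![c, 0; 0, 0], by simp [Matrix.trace_fin_two]⟩
  rw [LinearMap.range_eq_top.2 hs, finrank_top, finrank_self, Module.finrank_matrix] at h
  simp at h
  omega

lemma sl3aux_cases [CharZero K] [IsAlgClosed K] (L : LieSubalgebra k (sl (Fin 3) k))
    (hss : LieAlgebra.HasTrivialRadical k L) :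
    8 ≤ finrank k L ∨ finrank k L = 0 ∨
      (finrank k L = 3 ∧ Nonempty ((K ⊗[k] L) ≃ₗ⁅K⁆ (sl (Fin 2) K))) := by
  have hf1 : FiniteDimensional k (sl (Fin 3) k) :=
    inferInstanceAs (FiniteDimensional k (LinearMap.ker (Matrix.traceLinearMap (Fin 3) k k)))
  have hf2 : FiniteDimensional k L :=
    inferInstanceAs (FiniteDimensional k L.toSubmodule)
  have hK : LieAlgebra.IsKilling k L := inferInstance
  have hKA : LieAlgebra.IsKilling K (K ⊗[k] L) := sl3aux_isKilling_baseChange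
  have hrank : finrank K (K ⊗[k] L) = finrank k L := Module.finrank_baseChange
  obtain ⟨x, hx⟩ := LieAlgebra.exists_isCartanSubalgebra_engel K (K ⊗[k] L)
  rcases le_or_gt (finrank K (LieSubalgebra.engel K x)) 1 with h | h
  · right
    rcases sl3aux_rank_one (LieSubalgebra.engel K x) h with h | ⟨⟨e⟩⟩
    · left
      rw [← hrank]
      exact Module.finrank_zero_of_subsingleton
    · right
      refine ⟨?_, ⟨e⟩⟩
      rw [← hrank, e.toLinearEquiv.finrank_eq]
      exact sl3aux_finrank_sl2
  · left
    letI i1 : LieRingModule (K ⊗[k] L) (Fin 3 → K) :=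
      { bracket := fun x v => (sl3aux_phi K L x).mulVec v
        add_lie := fun x y v => by
          change (sl3aux_phi K L (x + y)).mulVec v = _
          rw [map_add, Matrix.add_mulVec]
        lie_add := fun x v w => Matrix.mulVec_add _ _ _
        leibniz_lie := fun x y v => by
          change (sl3aux_phi K L x).mulVec ((sl3aux_phi K L y).mulVec v) =
            (sl3aux_phi K L ⁅x, y⁆).mulVec v +
            (sl3aux_phi K L y).mulVec ((sl3aux_phi K L x).mulVec v)
          rw [sl3aux_phi_lie, Matrix.sub_mulVec]
          simp }
    letI i2 : LieModule K (K ⊗[k] L) (Fin 3 → K) :=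
      { smul_lie := fun c x v => by
          change (sl3aux_phi K L (c • x)).mulVec v = c • (sl3aux_phi K L x).mulVec v
          rw [map_smul, Matrix.smul_mulVec]
        lie_smul := fun c x v => Matrix.mulVec_smul _ _ _ }
    have hE : ∀ x : K ⊗[k] L, toEnd K (K ⊗[k] L) (Fin 3 → K) x =
        Matrix.toLin' (sl3aux_phi K L x) := fun x => by
      ext v
      rfl
    rw [← hrank]
    refine sl3aux_rank_two (V := Fin 3 → K) (LieSubalgebra.engel K x) ?_ (by simp) ?_ h
    · intro y z hyz
      rw [hE, hE] at hyz
      exact sl3aux_phi_injective K L (Matrix.toLin'.injective hyz)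
    · intro y
      rw [hE, Matrix.trace_toLin'_eq, sl3aux_phi_trace]

end final

end helpers

/-- **Trichotomy for semisimple Lie subalgebras of `sl(3)` over a field of characteristic
zero.**  If `L` is a Lie subalgebra of `sl(3,k)` which is semisimple (i.e. has no nonzero
solvable ideals), then exactly one of the following holds: `L = 0`; `L` is a form of
`sl(2,k)` (it is `3`-dimensional and its base change to an algebraic closure `k̄` is
isomorphic to `sl(2,k̄)`); or `L = sl(3,k)`. -/
theorem semisimple_subalgebra_sl3_trichotomy_forms
    (k : Type*) [Field k] [CharZero k]
    (L : LieSubalgebra k ↥(sl (Fin 3) k))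
    (hss : LieAlgebra.HasTrivialRadical k ↥L) :
    (L = ⊥ ∧
      ¬ (Module.finrank k ↥L = 3 ∧
          Nonempty ((AlgebraicClosure k ⊗[k] ↥L) ≃ₗ⁅AlgebraicClosure k⁆
            ↥(sl (Fin 2) (AlgebraicClosure k)))) ∧
      L ≠ ⊤) ∨
    (L ≠ ⊥ ∧
      (Module.finrank k ↥L = 3 ∧
          Nonempty ((AlgebraicClosure k ⊗[k] ↥L) ≃ₗ⁅AlgebraicClosure k⁆
            ↥(sl (Fin 2) (AlgebraicClosure k)))) ∧
      L ≠ ⊤) ∨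
    (L ≠ ⊥ ∧
      ¬ (Module.finrank k ↥L = 3 ∧
          Nonempty ((AlgebraicClosure k ⊗[k] ↥L) ≃ₗ⁅AlgebraicClosure k⁆
            ↥(sl (Fin 2) (AlgebraicClosure k)))) ∧
      L = ⊤) := by
  have hc : CharZero (AlgebraicClosure k) := inferInstance
  have h8 : Module.finrank k ↥(sl (Fin 3) k) = 8 := sl3aux_finrank_sl (F := k)
  have hf1 : FiniteDimensional k (sl (Fin 3) k) :=
    Module.finite_of_finrank_pos (by omega)
  have hbot : L = ⊥ → Module.finrank k ↥L = 0 := by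
    rintro rfl
    exact finrank_bot k _
  have htop : L = ⊤ → Module.finrank k ↥L = 8 := by
    rintro rfl
    rw [← h8]
    exact finrank_top k _
  rcases sl3aux_cases (AlgebraicClosure k) L hss with h | h | h
  · refine Or.inr (Or.inr ⟨fun e => ?_, fun e => ?_, ?_⟩)
    · have := hbot e; omega
    · have := e.1; omega
    · rw [← LieSubalgebra.toSubmodule_inj]
      apply Submodule.eq_top_of_finrank_eq
      have h1 : Module.finrank k L.toSubmodule ≤ Module.finrank k ↥(sl (Fin 3) k) :=
        Submodule.finrank_le _
      have h2 : Module.finrank k L.toSubmodule = Module.finrank k ↥L := rfl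
      omega
  · refine Or.inl ⟨?_, fun e => ?_, fun e => ?_⟩
    · rw [← LieSubalgebra.toSubmodule_inj]
      exact Submodule.finrank_eq_zero.1 h
    · have := e.1; omega
    · have := htop e; omega
  · refine Or.inr (Or.inl ⟨fun e => ?_, h, fun e => ?_⟩)
    · have := hbot e; have := h.1; omega
    · have := htop e; have := h.1; omega
end
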